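/- arXiv:1608.07656 — 4 statements merged into one kernel-verified Lean document; each statement's English description precedes it below -/
import Mathlib

section
/- Let p be a prime, k a perfect field of characteristic p, and e ≥ 1 an integer not divisible by p. Suppose there are a prime l dividing e and an integer n ≥ 1 such that k contains a primitive (l^n)-th root of unity but contains no primitive (l^(n+1))-th root of unity. Then there exist totally ramified extensions L₁ and L₂ of degree e of K = Frac(W(k)) such that there is no ring isomorphism L₁ ≃+* L₂. -/
set_option synthInstance.maxHeartbeats 1000000
set_option maxHeartbeats 1000000

open IsLocalRing

open Polynomial in
lemma aux_ext {R K : Type} [CommRing R] [IsDomain R] [IsDiscreteValuationRing R]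
    [Field K] [Algebra R K] [IsFractionRing R K] (b : R) (hb : Irreducible b) (e : ℕ) (he : 1 ≤ e) :
    ∃ (L : Type) (_ : Field L) (_ : Algebra R L) (_ : Algebra K L) (_ : IsScalarTower R K L) (π : L),
      Module.finrank K L = e ∧ π ^ e = algebraMap R L b ∧
      ∀ z : L, IsIntegral R z → ∃ (a : R) (w : L), IsIntegral R w ∧ z = algebraMap R L a + π * w := by
  set f : R[X] := X ^ e - C b with hf
  have hmon : f.Monic := monic_X_pow_sub_C b (by omega)
  have hdeg : f.natDegree = e := natDegree_X_pow_sub_C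
  have hbp : Prime b := hb.prime
  have heis : f.IsEisensteinAt (Submodule.span R {b}) := by
    refine ⟨?_, ?_, ?_⟩
    · rw [hmon.leadingCoeff]
      intro h
      exact hb.not_isUnit (isUnit_of_dvd_one (Ideal.mem_span_singleton.1 h))
    · intro n hn
      rw [hdeg] at hn
      rw [hf, coeff_sub, coeff_X_pow, if_neg (by omega), coeff_C]
      split_ifs
      · rw [zero_sub]; exact neg_mem (Ideal.mem_span_singleton_self b)
      · simp
    · rw [hf, coeff_sub, coeff_X_pow, if_neg (by omega), coeff_C_zero, zero_sub]
      intro h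
      have h := neg_mem h
      rw [neg_neg] at h
      have h2 : b ∈ Ideal.span {b ^ 2} := by
        rw [← Ideal.span_singleton_pow]; exact h
      obtain ⟨c, hc⟩ := Ideal.mem_span_singleton.1 h2
      have : b * 1 = b * (b * c) := by rw [mul_one]; rw [← mul_assoc, ← sq]; exact hc
      have := mul_left_cancel₀ hb.ne_zero this
      exact hb.not_isUnit (IsUnit.of_mul_eq_one _ this.symm)
  have hirr : Irreducible f := heis.irreducible ((Ideal.span_singleton_prime hb.ne_zero).2 hbp)
    hmon.isPrimitive (by omega)
  have hirrK : Irreducible (f.map (algebraMap R K)) :=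
    (hmon.irreducible_iff_irreducible_map_fraction_map).1 hirr
  have : Fact (Irreducible (f.map (algebraMap R K))) := ⟨hirrK⟩
  have hmonK := hmon.map (algebraMap R K)
  let B := AdjoinRoot.powerBasis hirrK.ne_zero
  have hgen : B.gen = AdjoinRoot.root (f.map (algebraMap R K)) := AdjoinRoot.powerBasis_gen _
  have hroot : aeval B.gen f = 0 := by
    rw [← aeval_map_algebraMap K, hgen, AdjoinRoot.aeval_eq, AdjoinRoot.mk_self]
  have hBint : IsIntegral R B.gen := ⟨f, hmon, hroot⟩
  have hminK : minpoly K B.gen = f.map (algebraMap R K) := by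
    rw [hgen, AdjoinRoot.minpoly_root hirrK.ne_zero, hmonK.leadingCoeff]; simp
  have hmin : minpoly R B.gen = f := by
    apply map_injective _ (IsFractionRing.injective R K)
    exact (minpoly.isIntegrallyClosed_eq_field_fractions' K hBint).symm.trans hminK
  refine ⟨AdjoinRoot (f.map (algebraMap R K)), inferInstance, inferInstance, inferInstance,
    inferInstance, B.gen, ?_, ?_, ?_⟩
  · rw [B.finrank, AdjoinRoot.powerBasis_dim, hmon.natDegree_map, hdeg]
  · have h : aeval B.gen (X ^ e - C b) = 0 := hroot
    rwa [map_sub, map_pow, aeval_X, aeval_C, sub_eq_zero] at h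
  · intro z hz
    have key : z ∈ Algebra.adjoin R ({B.gen} : Set (AdjoinRoot (f.map (algebraMap R K)))) := by
      obtain ⟨q, hq⟩ := B.exists_eq_aeval' z
      obtain ⟨d, hdm, hd⟩ := IsLocalization.integerNormalization_spec (nonZeroDivisors R) q
      obtain ⟨n, u, hu⟩ := IsDiscreteValuationRing.eq_unit_mul_pow_irreducible
        (nonZeroDivisors.ne_zero hdm) hb
      refine mem_adjoin_of_smul_prime_pow_smul_of_minpoly_isEisensteinAt (n := n) hbp hBint hz ?_
        (by rw [hmin]; exact heis)
      have h1 : d • z = aeval B.gen (IsLocalization.integerNormalization (nonZeroDivisors R) q) := by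
        rw [← aeval_map_algebraMap K, hd, hq]
        rw [← algebraMap_smul K d q, map_smul, algebraMap_smul]
      have h2 : (b ^ n) • z = (↑u⁻¹ : R) • (d • z) := by
        rw [hu, smul_smul, ← mul_assoc, Units.inv_mul, one_mul]
      rw [h2, h1]
      exact Subalgebra.smul_mem _ (aeval_mem_adjoin_singleton R _) _
    rw [Algebra.adjoin_singleton_eq_range_aeval] at key
    obtain ⟨q, hq⟩ := key
    have hq : aeval B.gen q = z := hq
    subst hq
    refine ⟨q.coeff 0, aeval B.gen q.divX, ?_, ?_⟩
    · exact adjoin_le_integralClosure hBint (aeval_mem_adjoin_singleton R _)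
    · have h := congrArg (aeval B.gen) (X_mul_divX_add q)
      rw [map_add, map_mul, aeval_X, aeval_C, add_comm] at h
      exact h.symm

lemma aux_local {R L : Type} [CommRing R] [IsDomain R] [IsDiscreteValuationRing R] [Field L]
    [Algebra R L] [FaithfulSMul R L] (b : R) (hb : Irreducible b) (e : ℕ) (he : 1 ≤ e)
    (π : L) (hπ : π ^ e = algebraMap R L b)
    (H : ∀ z : L, IsIntegral R z → ∃ (a : R) (w : L), IsIntegral R w ∧ z = algebraMap R L a + π * w) :
    (∃ _ : IsLocalRing (integralClosure R L),
      Ideal.span {algebraMap R (integralClosure R L) b} = maximalIdeal (integralClosure R L) ^ e) ∧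
    (∀ (a : R) (w : L), IsIntegral R w → algebraMap R L a = π * w → ¬ IsUnit a) := by
  have hπi : IsIntegral R π := by
    apply IsIntegral.of_pow (n := e) (by omega)
    rw [hπ]; exact isIntegral_algebraMap
  let P : integralClosure R L := ⟨π, hπi⟩
  have hP : P ^ e = algebraMap R (integralClosure R L) b := Subtype.ext hπ
  have hPu : ¬ IsUnit P := by
    intro h
    have h := h.pow e
    rw [hP] at h
    exact hb.not_isUnit (isUnit_of_map_unit (algebraMap R (integralClosure R L)) b h)
  have hstar : ∀ (a : R) (w : L), IsIntegral R w → algebraMap R L a = π * w → ¬ IsUnit a := by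
    intro a w hw h ha
    have h1 : algebraMap R (integralClosure R L) a = P * ⟨w, hw⟩ := Subtype.ext h
    have := ha.map (algebraMap R (integralClosure R L))
    rw [h1] at this
    exact hPu (isUnit_of_mul_isUnit_left this)
  refine ⟨?_, hstar⟩
  have hmax : ∀ M : Ideal (integralClosure R L), M.IsMaximal → M = Ideal.span {P} := by
    intro M hM
    have hbM : b ∈ M.comap (algebraMap R (integralClosure R L)) := by
      have : (M.comap (algebraMap R (integralClosure R L))).IsMaximal :=
        Ideal.isMaximal_comap_of_isIntegral_of_isMaximal M
      rw [IsLocalRing.eq_maximalIdeal this]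
      exact (mem_maximalIdeal _).2 hb.not_isUnit
    have hPM : P ∈ M := by
      apply hM.isPrime.mem_of_pow_mem e
      rw [hP]; exact hbM
    apply le_antisymm
    · intro z hz
      obtain ⟨a, w, hw, h⟩ := H z z.2
      have h1 : z = algebraMap R (integralClosure R L) a + P * ⟨w, hw⟩ := Subtype.ext h
      have ha : algebraMap R (integralClosure R L) a ∈ M := by
        rw [eq_sub_of_add_eq h1.symm]
        exact sub_mem hz (M.mul_mem_right _ hPM)
      have hau : ¬ IsUnit a := fun hu => hM.ne_top (Ideal.eq_top_of_isUnit_mem _ ha (hu.map _))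
      have : a ∈ Ideal.span {b} := by
        rw [← hb.maximalIdeal_eq]; exact hau
      obtain ⟨c, rfl⟩ := Ideal.mem_span_singleton.1 this
      rw [h1, map_mul, ← hP, Ideal.mem_span_singleton]
      exact dvd_add ((dvd_pow_self P (by omega)).mul_right _) (dvd_mul_right _ _)
    · rw [Ideal.span_singleton_le_iff_mem]; exact hPM
  obtain ⟨M, hM⟩ := Ideal.exists_maximal (integralClosure R L)
  have hloc : IsLocalRing (integralClosure R L) :=
    IsLocalRing.of_unique_max_ideal ⟨M, hM, fun N hN => (hmax N hN).trans (hmax M hM).symm⟩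
  refine ⟨hloc, ?_⟩
  rw [hmax _ (maximalIdeal.isMaximal _), Ideal.span_singleton_pow, hP]

theorem exists_nonisomorphic_tame_totally_ramified (p : ℕ) [Fact p.Prime]
    (k : Type) [Field k] [CharP k p] [PerfectRing k p]
    (e : ℕ) (he : 1 ≤ e) (hpe : ¬ p ∣ e)
    (l : ℕ) (hl : l.Prime) (hle : l ∣ e) (n : ℕ) (hn : 1 ≤ n)
    (hroot : ∃ ζ : k, IsPrimitiveRoot ζ (l ^ n))
    (hnoroot : ¬ ∃ ζ : k, IsPrimitiveRoot ζ (l ^ (n + 1))) :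
    ∃ (L₁ L₂ : Type) (_ : Field L₁) (_ : Field L₂)
      (_ : Algebra (WittVector p k) L₁) (_ : Algebra (WittVector p k) L₂)
      (_ : Algebra (FractionRing (WittVector p k)) L₁)
      (_ : Algebra (FractionRing (WittVector p k)) L₂)
      (_ : IsScalarTower (WittVector p k) (FractionRing (WittVector p k)) L₁)
      (_ : IsScalarTower (WittVector p k) (FractionRing (WittVector p k)) L₂)
      (_ : IsLocalRing (integralClosure (WittVector p k) L₁))
      (_ : IsLocalRing (integralClosure (WittVector p k) L₂)),
      Module.finrank (FractionRing (WittVector p k)) L₁ = e ∧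
      Module.finrank (FractionRing (WittVector p k)) L₂ = e ∧
      Ideal.span {(p : ↥(integralClosure (WittVector p k) L₁))} =
        maximalIdeal (integralClosure (WittVector p k) L₁) ^ e ∧
      Ideal.span {(p : ↥(integralClosure (WittVector p k) L₂))} =
        maximalIdeal (integralClosure (WittVector p k) L₂) ^ e ∧
      IsEmpty (L₁ ≃+* L₂) := by
  obtain ⟨ζ, hζ⟩ := hroot
  have hζ0 : ζ ≠ 0 := hζ.ne_zero (pow_pos hl.pos n).ne'
  let t : WittVector p k := WittVector.teichmuller p ζ
  have ht0 : WittVector.constantCoeff t = ζ := WittVector.teichmuller_coeff_zero p ζ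
  have ht : IsUnit t := WittVector.isUnit_of_coeff_zero_ne_zero t (by
    rw [show t.coeff 0 = ζ from ht0]; exact hζ0)
  have hp : Irreducible (p : WittVector p k) := WittVector.irreducible p
  have hpt : Irreducible ((p : WittVector p k) * t) := (irreducible_mul_isUnit ht).2 hp
  obtain ⟨L₁, i1, i2, i3, i4, π₁, hr₁, hπ₁, H₁⟩ :=
    aux_ext (K := FractionRing (WittVector p k)) (p : WittVector p k) hp e he
  obtain ⟨L₂, j1, j2, j3, j4, π₂, hr₂, hπ₂, H₂⟩ :=
    aux_ext (K := FractionRing (WittVector p k)) ((p : WittVector p k) * t) hpt e he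
  have : FaithfulSMul (WittVector p k) L₁ :=
    FaithfulSMul.trans (WittVector p k) (FractionRing (WittVector p k)) L₁
  have : FaithfulSMul (WittVector p k) L₂ :=
    FaithfulSMul.trans (WittVector p k) (FractionRing (WittVector p k)) L₂
  obtain ⟨⟨loc₁, hm₁⟩, -⟩ := aux_local _ hp e he π₁ hπ₁ H₁
  obtain ⟨⟨loc₂, hm₂⟩, hu₂⟩ := aux_local _ hpt e he π₂ hπ₂ H₂
  refine ⟨L₁, L₂, i1, j1, i2, j2, i3, j3, i4, j4, loc₁, loc₂, hr₁, hr₂, ?_, ?_, ⟨fun σ => ?_⟩⟩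
  · rw [← hm₁, map_natCast]
  · rw [← hm₂, map_mul, map_natCast]
    exact (Ideal.span_singleton_mul_right_unit (ht.map _) _).symm
  · have h1 : (σ π₁) ^ e = (p : L₂) := by rw [← map_pow, hπ₁, map_natCast, map_natCast]
    rw [map_mul, map_natCast] at hπ₂
    have hp0 : (p : L₂) ≠ 0 := by
      rw [← map_natCast (algebraMap (WittVector p k) L₂)]
      exact (map_ne_zero_iff _ (FaithfulSMul.algebraMap_injective _ _)).2 hp.ne_zero
    have h2 : (π₂ / σ π₁) ^ e = algebraMap _ L₂ t := by
      rw [div_pow, h1, hπ₂, mul_div_cancel_left₀ _ hp0]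
    have hint : IsIntegral (WittVector p k) (π₂ / σ π₁) := by
      apply IsIntegral.of_pow (n := e) (by omega)
      rw [h2]; exact isIntegral_algebraMap
    obtain ⟨a, w, hw, haw⟩ := H₂ _ hint
    have hπi : IsIntegral (WittVector p k) π₂ := by
      apply IsIntegral.of_pow (n := e) (by omega)
      rw [hπ₂, ← map_natCast (algebraMap (WittVector p k) L₂), ← map_mul]
      exact isIntegral_algebraMap
    obtain ⟨c, hc⟩ : ∃ c : integralClosure (WittVector p k) L₂,
        (algebraMap _ L₂ (t - a ^ e)) = π₂ * c := by
      have := sub_dvd_pow_sub_pow (algebraMap _ (integralClosure (WittVector p k) L₂) a +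
        ⟨π₂, hπi⟩ * ⟨w, hw⟩) (algebraMap _ (integralClosure (WittVector p k) L₂) a) e
      rw [add_sub_cancel_left] at this
      obtain ⟨c, hc⟩ := (dvd_mul_right _ _).trans this
      refine ⟨c, ?_⟩
      have hc' := congrArg (fun x : integralClosure (WittVector p k) L₂ => (x : L₂)) hc
      rw [map_sub, map_pow, ← h2, haw]
      exact hc'
    have hnu := hu₂ _ _ c.2 hc
    have hz : (t - a ^ e).coeff 0 = 0 := by
      by_contra h
      exact hnu (WittVector.isUnit_of_coeff_zero_ne_zero _ h)
    have hz : WittVector.constantCoeff (t - a ^ e) = 0 := hz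
    rw [map_sub, map_pow, ht0, sub_eq_zero] at hz
    obtain ⟨m, rfl⟩ := hle
    refine hnoroot ⟨WittVector.constantCoeff a ^ m, ?_⟩
    have hw : (WittVector.constantCoeff a ^ m) ^ l = ζ := by rw [← pow_mul, mul_comm, ← hz]
    have := Fact.mk hl
    rw [IsPrimitiveRoot.iff_orderOf]
    apply orderOf_eq_prime_pow
    · obtain ⟨n, rfl⟩ := Nat.exists_eq_add_of_le' hn
      rw [pow_succ', pow_mul, hw]
      exact hζ.pow_ne_one_of_pos_of_lt (pow_pos hl.pos n).ne' (Nat.pow_lt_pow_right hl.one_lt (by omega))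
    · rw [pow_succ', pow_mul, hw, hζ.pow_eq_one]
end

section
/- Let p be a prime, k a perfect field of characteristic p, and e a positive integer divisible by p. Then there exist totally ramified extensions L₁ and L₂ of degree e of K = Frac(W(k)) such that there is no ring isomorphism L₁ ≃+* L₂. -/
set_option synthInstance.maxHeartbeats 1000000
set_option maxHeartbeats 1000000

open IsLocalRing

namespace WildAux

open Polynomial

theorem eis_facts {R : Type} [CommRing R] [IsDomain R]
    {ϖ : R} (hϖ : Prime ϖ) (c : R) (e : ℕ) (he : 2 ≤ e) (f : R[X])
    (hf : f = X ^ e - C (c * ϖ) * X - C ϖ) :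
    f.Monic ∧ f.natDegree = e ∧ f.IsEisensteinAt (Ideal.span {ϖ}) := by
  have hd : (C (c * ϖ) * X + C ϖ : R[X]).degree < (e : ℕ) :=
    lt_of_le_of_lt degree_linear_le (by exact_mod_cast he)
  have hf' : f = X ^ e - (C (c * ϖ) * X + C ϖ) := by rw [hf]; ring
  have hm : f.Monic := by rw [hf']; exact monic_X_pow_sub hd
  have hn : f.natDegree = e := by
    apply natDegree_eq_of_degree_eq_some
    rw [hf', degree_sub_eq_left_of_degree_lt] <;> rw [degree_X_pow]
    exact hd
  have hp : (Ideal.span {ϖ} : Ideal R).IsPrime := (Ideal.span_singleton_prime hϖ.ne_zero).2 hϖ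
  refine ⟨hm, hn, hm.isEisensteinAt_of_mem_of_notMem hp.ne_top ?_ ?_⟩
  · intro n h
    rw [hn] at h
    rw [hf', coeff_sub, coeff_X_pow, if_neg h.ne, coeff_add, coeff_C_mul, Ideal.mem_span_singleton,
      coeff_C]
    split_ifs
    · exact ⟨-(c * X.coeff n + 1), by ring⟩
    · exact ⟨-(c * X.coeff n), by ring⟩
  · have h0 : f.coeff 0 = -ϖ := by
      rw [hf', coeff_sub, coeff_X_pow, if_neg (by omega)]; simp
    rw [h0, Ideal.span_singleton_pow, Ideal.mem_span_singleton, dvd_neg]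
    rintro ⟨d, hd⟩
    apply hϖ.not_isUnit
    refine IsUnit.of_mul_eq_one d (mul_left_cancel₀ hϖ.ne_zero ?_)
    rw [mul_one]; rw [sq, mul_assoc] at hd; exact hd.symm

theorem local_facts {R O : Type} [CommRing R] [IsDomain R] [IsDiscreteValuationRing R]
    [CommRing O] [IsDomain O] [Algebra R O] [Algebra.IsIntegral R O]
    {ϖ : R} (hϖ : Irreducible ϖ) (e : ℕ) (he : 2 ≤ e) (c : R) (x : O)
    (hx : x ^ e = algebraMap R O ϖ * (1 + algebraMap R O c * x))
    (hO : ∀ y : O, ∃ (a : R) (b : O), y = algebraMap R O a + x * b) :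
    ∃ _ : IsLocalRing O, maximalIdeal O = Ideal.span {x} ∧
      Ideal.span {algebraMap R O ϖ} = maximalIdeal O ^ e := by
  have hmax : ∀ M : Ideal O, M.IsMaximal → x ∈ M := by
    intro M hM
    have h1 := Ideal.isMaximal_comap_of_isIntegral_of_isMaximal (R := R) M
    have h2 := IsLocalRing.eq_maximalIdeal h1
    have h3 : ϖ ∈ M.comap (algebraMap R O) := by
      rw [h2]; exact (IsLocalRing.mem_maximalIdeal _).2 hϖ.not_isUnit
    apply hM.isPrime.mem_of_pow_mem e
    rw [hx]
    exact M.mul_mem_right _ h3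
  have hdvd : x ∣ algebraMap R O ϖ := by
    refine ⟨x ^ (e - 1) - algebraMap R O (ϖ * c), ?_⟩
    have : x * x ^ (e - 1) = x ^ e := by rw [← pow_succ']; congr 1; omega
    rw [mul_sub, this, hx, map_mul]; ring
  have hxn : ¬ IsUnit x := by
    intro h
    obtain ⟨M, hM⟩ := Ideal.exists_maximal O
    exact hM.ne_top (Ideal.eq_top_of_isUnit_mem _ (hmax M hM) h)
  have hunit : ∀ (a : R) (b : O), IsUnit a → IsUnit (algebraMap R O a + x * b) := by
    intro a b ha
    by_contra h
    obtain ⟨M, hM, hm⟩ := exists_max_ideal_of_mem_nonunits h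
    have : algebraMap R O a ∈ M := by
      have := M.sub_mem hm (M.mul_mem_right b (hmax M hM))
      simpa using this
    exact hM.ne_top (Ideal.eq_top_of_isUnit_mem _ this (ha.map _))
  have hnon : ∀ y : O, y ∈ nonunits O ↔ y ∈ Ideal.span {x} := by
    intro y
    constructor
    · intro hy
      obtain ⟨a, b, rfl⟩ := hO y
      have ha : ¬ IsUnit a := fun h => hy (hunit a b h)
      have ha' : a ∈ maximalIdeal R := ha
      rw [hϖ.maximalIdeal_eq, Ideal.mem_span_singleton] at ha'
      rw [Ideal.mem_span_singleton]
      exact dvd_add (hdvd.trans (map_dvd _ ha')) (dvd_mul_right _ _)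
    · intro hy h
      rw [Ideal.mem_span_singleton] at hy
      exact hxn (isUnit_of_dvd_unit hy h)
  have hl : IsLocalRing O := IsLocalRing.of_nonunits_add (fun a b ha hb => by
    rw [hnon] at *; exact Ideal.add_mem _ ha hb)
  refine ⟨hl, ?_, ?_⟩
  · ext y; exact hnon y
  · have h1 : maximalIdeal O = Ideal.span {x} := by ext y; exact hnon y
    rw [h1, Ideal.span_singleton_pow, Ideal.span_singleton_eq_span_singleton, hx]
    have hu := hunit 1 (algebraMap R O c) isUnit_one
    rw [map_one, mul_comm x] at hu
    exact (associated_mul_unit_right _ _ hu)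

theorem exists_ext {R K : Type} [CommRing R] [IsDomain R] [IsDiscreteValuationRing R]
    [Field K] [Algebra R K] [IsFractionRing R K]
    {ϖ : R} (hϖ : Irreducible ϖ) (c : R) (e : ℕ) (he : 2 ≤ e) :
    ∃ (L : Type) (_ : Field L) (_ : Algebra R L) (_ : Algebra K L) (_ : IsScalarTower R K L)
      (_ : IsLocalRing (integralClosure R L)) (x : integralClosure R L),
      Module.finrank K L = e ∧ maximalIdeal (integralClosure R L) = Ideal.span {x} ∧
      Ideal.span {algebraMap R (integralClosure R L) ϖ} = maximalIdeal (integralClosure R L) ^ e ∧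
      x ≠ 0 ∧
      x ^ e = algebraMap R _ ϖ * (1 + algebraMap R _ c * x) := by
  obtain ⟨f, hf⟩ : ∃ f : R[X], f = X ^ e - C (c * ϖ) * X - C ϖ := ⟨_, rfl⟩
  obtain ⟨hm, hn, hE⟩ := eis_facts hϖ.prime c e he f hf
  have hp : (Ideal.span {ϖ} : Ideal R).IsPrime :=
    (Ideal.span_singleton_prime hϖ.ne_zero).2 hϖ.prime
  have hirr : Irreducible f := hE.irreducible hp hm.isPrimitive (by omega)
  have hirrK : Irreducible (f.map (algebraMap R K)) :=
    (hm.irreducible_iff_irreducible_map_fraction_map).1 hirr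
  have hmK := hm.map (algebraMap R K)
  haveI : Fact (Irreducible (f.map (algebraMap R K))) := ⟨hirrK⟩
  let L := AdjoinRoot (f.map (algebraMap R K))
  let B : PowerBasis K L := AdjoinRoot.powerBasis hmK.ne_zero
  have hroot : aeval B.gen f = 0 := by
    have h1 : minpoly K B.gen = f.map (algebraMap R K) :=
      AdjoinRoot.minpoly_powerBasis_gen_of_monic hmK
    have h2 := minpoly.aeval K B.gen
    rwa [congrArg (aeval B.gen) h1, aeval_map_algebraMap] at h2
  have hint : IsIntegral R B.gen := ⟨f, hm, hroot⟩
  have hmin : minpoly R B.gen = f := by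
    apply map_injective (algebraMap R K) (IsFractionRing.injective R K)
    rw [← minpoly.isIntegrallyClosed_eq_field_fractions' K hint]
    exact AdjoinRoot.minpoly_powerBasis_gen_of_monic hmK
  have hadj : ∀ z : L, IsIntegral R z → z ∈ Algebra.adjoin R ({B.gen} : Set L) := by
    intro z hz
    obtain ⟨q, rfl⟩ := B.exists_eq_aeval' z
    obtain ⟨b, hb⟩ := IsLocalization.integerNormalization_map_to_map (nonZeroDivisors R) q
    obtain ⟨n, u, hu⟩ := IsDiscreteValuationRing.eq_unit_mul_pow_irreducible
      (nonZeroDivisors.ne_zero b.2) hϖ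
    apply mem_adjoin_of_smul_prime_pow_smul_of_minpoly_isEisensteinAt hϖ.prime hint (n := n) hz
    · have h1 : (b : R) • aeval B.gen q ∈ Algebra.adjoin R ({B.gen} : Set L) := by
        have : (b : R) • aeval B.gen q =
            aeval B.gen (IsLocalization.integerNormalization (nonZeroDivisors R) q) := by
          rw [← aeval_map_algebraMap K B.gen (IsLocalization.integerNormalization _ q), hb, Algebra.smul_def, Algebra.smul_def,
            map_mul, IsScalarTower.algebraMap_apply R K K[X], IsScalarTower.algebraMap_apply R K L]
          simp
        rw [this]
        exact aeval_mem_adjoin_singleton _ _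
      have h2 := Subalgebra.smul_mem _ h1 (↑(u⁻¹) : R)
      rwa [smul_smul, hu, ← mul_assoc, Units.inv_mul, one_mul] at h2
    · rw [hmin]; exact hE
  let x : integralClosure R L := ⟨B.gen, hint⟩
  have hx : x ^ e = algebraMap R _ ϖ * (1 + algebraMap R _ c * x) := by
    apply Subtype.ext
    have : B.gen ^ e = algebraMap R L ϖ * (1 + algebraMap R L c * B.gen) := by
      have hroot := hroot
      rw [congrArg (aeval B.gen) hf] at hroot
      simp only [map_sub, map_mul, map_pow, aeval_X, aeval_C] at hroot
      linear_combination hroot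
    exact this
  have hO : ∀ y : integralClosure R L, ∃ (a : R) (b : integralClosure R L),
      y = algebraMap R _ a + x * b := by
    rintro ⟨y, hy⟩
    have h := hadj y hy
    rw [Algebra.adjoin_singleton_eq_range_aeval] at h
    obtain ⟨q, rfl⟩ := h
    refine ⟨q.coeff 0, aeval x q.divX, ?_⟩
    apply Subtype.ext
    have h3 : ((aeval x q.divX : integralClosure R L) : L) = aeval B.gen q.divX := by
      have := aeval_algHom_apply (integralClosure R L).val x q.divX
      exact this.symm
    change aeval B.gen q = algebraMap R L (q.coeff 0) + B.gen * ((aeval x q.divX : integralClosure R L) : L)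
    rw [h3]
    conv_lhs => rw [← divX_mul_X_add q]
    simp only [map_add, map_mul, aeval_X, aeval_C]
    ring
  obtain ⟨hl, h1, h2⟩ := local_facts hϖ e he c x hx hO
  refine ⟨L, inferInstance, inferInstance, inferInstance, inferInstance, hl, x, ?_, h1, h2, ?_, hx⟩
  · rw [B.finrank]
    change (f.map (algebraMap R K)).natDegree = e
    rw [hm.natDegree_map, hn]
  · rintro h0
    rw [h0, zero_pow (by omega), mul_zero, add_zero, mul_one] at hx
    have h4 : algebraMap R L ϖ = 0 := congrArg Subtype.val hx.symm
    rw [IsScalarTower.algebraMap_apply R K L, map_eq_zero,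
      IsFractionRing.to_map_eq_zero_iff] at h4
    exact hϖ.ne_zero h4

theorem no_root {O : Type} [CommRing O] [IsDomain O] [IsLocalRing O] (p : ℕ) (hp : p.Prime)
    (x v : O) (hx : maximalIdeal O = Ideal.span {x}) (hx0 : x ≠ 0)
    (hpm : (p : O) ∈ maximalIdeal O) (hv : v ^ p = 1 + x) : False := by
  obtain ⟨r, hr⟩ := exists_add_pow_prime_eq hp (v - 1) 1
  rw [sub_add_cancel, hv, one_pow, mul_one] at hr
  have hxm : x ∈ maximalIdeal O := hx ▸ Ideal.mem_span_singleton_self x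
  have ht : v - 1 ∈ maximalIdeal O := by
    apply (inferInstance : (maximalIdeal O).IsPrime).mem_of_pow_mem p
    have : (v - 1) ^ p = x - p * ((v - 1) * r) := by linear_combination -hr
    rw [this]
    exact Ideal.sub_mem _ hxm (Ideal.mul_mem_right _ _ hpm)
  rw [hx, Ideal.mem_span_singleton] at ht hpm
  obtain ⟨s, hs⟩ := ht
  obtain ⟨d, hd⟩ := hpm
  obtain ⟨q, rfl⟩ := Nat.exists_eq_add_of_le hp.two_le
  rw [hs, hd] at hr
  apply (mem_maximalIdeal x).1 hxm
  refine IsUnit.of_mul_eq_one (x ^ q * s ^ (2 + q) + d * s * r) (mul_left_cancel₀ hx0 ?_)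
  linear_combination -hr

end WildAux

/-- If `p ∣ e`, then there are two non-isomorphic totally ramified extensions of degree
`e` of `K = Frac(W(k))`. -/
theorem exists_nonisomorphic_wild_totally_ramified (p : ℕ) [Fact p.Prime]
    (k : Type) [Field k] [CharP k p] [PerfectRing k p]
    (e : ℕ) (he : 1 ≤ e) (hpe : p ∣ e) :
    ∃ (L₁ L₂ : Type) (_ : Field L₁) (_ : Field L₂)
      (_ : Algebra (WittVector p k) L₁) (_ : Algebra (WittVector p k) L₂)
      (_ : Algebra (FractionRing (WittVector p k)) L₁)
      (_ : Algebra (FractionRing (WittVector p k)) L₂)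
      (_ : IsScalarTower (WittVector p k) (FractionRing (WittVector p k)) L₁)
      (_ : IsScalarTower (WittVector p k) (FractionRing (WittVector p k)) L₂)
      (_ : IsLocalRing (integralClosure (WittVector p k) L₁))
      (_ : IsLocalRing (integralClosure (WittVector p k) L₂)),
      Module.finrank (FractionRing (WittVector p k)) L₁ = e ∧
      Module.finrank (FractionRing (WittVector p k)) L₂ = e ∧
      Ideal.span {(p : ↥(integralClosure (WittVector p k) L₁))} =
        maximalIdeal (integralClosure (WittVector p k) L₁) ^ e ∧
      Ideal.span {(p : ↥(integralClosure (WittVector p k) L₂))} =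
        maximalIdeal (integralClosure (WittVector p k) L₂) ^ e ∧
      IsEmpty (L₁ ≃+* L₂) := by
  have hpp : p.Prime := Fact.out
  have he2 : 2 ≤ e := hpp.two_le.trans (Nat.le_of_dvd he hpe)
  have hirr : Irreducible (p : WittVector p k) := WittVector.irreducible p
  obtain ⟨L₁, i1, i2, i3, i4, i5, x, hfin, hmx, hsp, hx0, hx⟩ :=
    WildAux.exists_ext (K := FractionRing (WittVector p k)) hirr 0 e he2
  obtain ⟨L₂, j1, j2, j3, j4, j5, y, gfin, gmy, gsp, hy0, hy⟩ :=
    WildAux.exists_ext (K := FractionRing (WittVector p k)) hirr 1 e he2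
  rw [map_natCast] at hsp gsp hx hy
  refine ⟨L₁, L₂, i1, j1, i2, j2, i3, j3, i4, j4, i5, j5, hfin, gfin, hsp, gsp, ⟨fun φ => ?_⟩⟩
  have hpm : (p : integralClosure (WittVector p k) L₂) ∈ maximalIdeal _ := by
    have : (p : integralClosure (WittVector p k) L₂) ∈
        maximalIdeal (integralClosure (WittVector p k) L₂) ^ e :=
      gsp ▸ Ideal.mem_span_singleton_self _
    exact Ideal.pow_le_self (by omega) this
  have hx' : (x : L₁) ^ e = (p : L₁) := by
    have := congrArg Subtype.val hx
    simpa using this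
  have hy' : (y : L₂) ^ e = (p : L₂) * (1 + y) := by
    have := congrArg Subtype.val hy
    simpa using this
  have hz : (φ x) ^ e = (p : L₂) := by rw [← map_pow, hx', map_natCast]
  have hy0' : (y : L₂) ≠ 0 := fun h => hy0 (Subtype.ext h)
  have hp0 : (p : L₂) ≠ 0 := by
    intro h
    rw [h, zero_mul] at hy'
    exact hy0' (pow_eq_zero_iff (by omega) |>.1 hy')
  have hw : ((y : L₂) / φ x) ^ e = 1 + y := by
    rw [div_pow, hz, hy', mul_div_cancel_left₀ _ hp0]
  have hwi : IsIntegral (WittVector p k) ((y : L₂) / φ x) := by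
    apply IsIntegral.of_pow (n := e) (by omega)
    rw [hw]
    exact (isIntegral_one.add y.2)
  obtain ⟨m, rfl⟩ := hpe
  refine WildAux.no_root p hpp y (⟨_, hwi⟩ ^ m) gmy hy0 hpm (Subtype.ext ?_)
  rw [← pow_mul, mul_comm m p]
  exact hw
end

section
/- Let p be a prime, k a perfect field of characteristic p, and e ≥ 1 an integer not divisible by p. Suppose the unit group kˣ is e-divisible, i.e. for every a : kˣ there exists b : kˣ with b^e = a. Then any two totally ramified extensions L₁ and L₂ of degree e of K = Frac(W(k)) are isomorphic as K-algebras. -/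
set_option synthInstance.maxHeartbeats 1000000
set_option maxHeartbeats 1000000

open IsLocalRing

open TensorProduct in
theorem aux_complete {R S : Type} [CommRing R] [IsNoetherianRing R] (I : Ideal R)
    [IsAdicComplete I R] [CommRing S] [Algebra R S] [Module.Finite R S] :
    IsAdicComplete (I.map (algebraMap R S)) S := by
  have h : IsAdicComplete I S := by
    rw [← AdicCompletion.of_bijective_iff]
    let φ : R ≃ₗ[R] AdicCompletion I R :=
      LinearEquiv.ofBijective (AdicCompletion.of I R) (AdicCompletion.of_bijective_iff.2 inferInstance)
    have h1 := AdicCompletion.ofTensorProduct_bijective_of_finite_of_isNoetherian I S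
    have h2 := h1.comp (((TensorProduct.lid R S).symm.trans (φ.rTensor S)).bijective)
    convert h2 using 1
    ext1 x
    simp only [Function.comp, LinearEquiv.trans_apply, TensorProduct.lid_symm_apply, LinearEquiv.rTensor_tmul,
      AdicCompletion.ofTensorProduct_tmul]
    have : φ 1 = 1 := rfl
    rw [this, one_smul]
  have h1 : IsHausdorff (I.map (algebraMap R S)) S := by
    rw [IsHausdorff.map_algebraMap_iff]; infer_instance
  have h2 : IsPrecomplete (I.map (algebraMap R S)) S := by
    rw [IsPrecomplete.map_algebraMap_iff]; infer_instance
  exact { h1, h2 with }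

/-- e-th roots of 1-units -/
theorem aux_root {S : Type} [CommRing S] [IsLocalRing S] (p : ℕ) [Fact p.Prime]
    (e : ℕ) (he : 1 ≤ e) (hpe : ¬ p ∣ e)
    (hram : Ideal.span {(p : S)} = maximalIdeal S ^ e)
    [IsAdicComplete (Ideal.span {(p : S)}) S] (v : S) (hv : v - 1 ∈ maximalIdeal S) :
    ∃ y : S, y ^ e = v := by
  have hp := Fact.out (p := p.Prime)
  have hcop : Nat.Coprime p e := (Nat.Prime.coprime_iff_not_dvd hp).2 hpe
  have hpm : (p : S) ∈ maximalIdeal S := by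
    have : (p : S) ∈ maximalIdeal S ^ e := hram ▸ Ideal.mem_span_singleton_self _
    exact Ideal.pow_le_self (by omega) this
  have hvu : IsUnit v := by
    by_contra h
    have h' : v ∈ maximalIdeal S := h
    have := Ideal.sub_mem _ h' hv
    simp at this
  have heu : IsUnit (e : S) := by
    by_contra h
    have h' : (e : S) ∈ maximalIdeal S := h
    have hz : IsCoprime (p : ℤ) (e : ℤ) := Nat.isCoprime_iff_coprime.2 hcop
    obtain ⟨a, b, hab⟩ := hz
    have h3 := Ideal.add_mem _ (Ideal.mul_mem_left _ (a : S) hpm) (Ideal.mul_mem_left _ (b : S) h')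
    have h4 : (a : S) * p + b * e = 1 := by exact_mod_cast congrArg (Int.cast : ℤ → S) hab
    rw [h4] at h3
    exact (Ideal.ne_top_iff_one _).1 (maximalIdeal.isMaximal S).ne_top h3
  -- v^(p^e) ≡ 1 mod p
  have hN : v ^ (p ^ e) - 1 ∈ Ideal.span {(p : S)} := by
    have h1 : (v - 1) ^ (p ^ e) ∈ Ideal.span {(p : S)} := by
      rw [hram]
      exact Ideal.pow_le_pow_right (Nat.lt_pow_self hp.one_lt).le (Ideal.pow_mem_pow hv _)
    obtain ⟨r, hr⟩ := exists_add_pow_prime_pow_eq hp (v - 1) 1 e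
    rw [sub_add_cancel, one_pow] at hr
    rw [hr]
    have : (v - 1) ^ p ^ e + 1 + p * (v - 1) * 1 * r - 1 = (v-1)^p^e + p * ((v-1) * r) := by ring
    rw [this]
    exact Ideal.add_mem _ h1 (Ideal.mul_mem_right _ _ (Ideal.mem_span_singleton_self _))
  obtain ⟨y, hy, -⟩ := HenselianRing.is_henselian (I := Ideal.span {(p : S)})
    (Polynomial.X ^ e - Polynomial.C (v ^ (p ^ e))) (Polynomial.monic_X_pow_sub_C _ (by omega)) 1
    (by 
      have := Ideal.neg_mem_iff _ |>.2 hN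
      simpa using this) 
    (by 
      apply IsUnit.map
      simpa [-map_pow, Polynomial.derivative_X_pow] using heu)
  have hy : y ^ e = v ^ p ^ e := by
    simpa [Polynomial.IsRoot, sub_eq_zero] using hy
  have hyu : IsUnit y := by
    rw [← isUnit_pow_iff (n := e) (by omega), hy]; exact hvu.pow _
  obtain ⟨y, rfl⟩ := hyu
  obtain ⟨v, rfl⟩ := hvu
  have hz : IsCoprime ((p ^ e : ℕ) : ℤ) (e : ℤ) := Nat.isCoprime_iff_coprime.2 (hcop.pow_left _)
  obtain ⟨a, b, hab⟩ := hz
  have hy' : y ^ e = v ^ (p ^ e) := by ext; simpa using hy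
  refine ⟨((y ^ a * v ^ b : Sˣ) : S), ?_⟩
  rw [← Units.val_pow_eq_pow_val]
  congr 1
  calc (y ^ a * v ^ b) ^ e = (y ^ e) ^ a * v ^ (b * e) := by
        rw [mul_pow, zpow_mul, zpow_natCast, ← zpow_natCast (y ^ a), ← zpow_natCast y,
          zpow_comm]
    _ = v ^ (a * (p ^ e : ℕ) + b * e) := by
        rw [hy', zpow_add, mul_comm a, zpow_mul v _ a, zpow_natCast v]
    _ = v := by rw [hab, zpow_one]

theorem aux_key {R S K L : Type} [CommRing R] [IsDomain R] [IsDiscreteValuationRing R]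
    [CommRing S] [IsDomain S] [IsDedekindDomain S] [IsLocalRing S] [Field K] [Field L]
    [Algebra R S] [Algebra R K] [IsFractionRing R K] [Algebra S L] [IsFractionRing S L]
    [Algebra K L] [Algebra R L] [IsScalarTower R S L] [IsScalarTower R K L] [Module.Finite R S]
    (p : ℕ) [Fact p.Prime] (hirr : Irreducible (p : R)) 
    [IsAdicComplete (Ideal.span {(p : R)}) R]
    (e : ℕ) (he : 1 ≤ e) (hpe : ¬ p ∣ e)
    (hdiv : ∀ u : R, IsUnit u → ∃ v : R, (p : R) ∣ v ^ e - u)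
    (hrank : Module.finrank K L = e)
    (hram : Ideal.span {(p : S)} = maximalIdeal S ^ e) :
    ∃ x : S, x ^ e = p := by
  have hp := Fact.out (p := p.Prime)
  have hmap : (Ideal.span {(p : R)}).map (algebraMap R S) = Ideal.span {(p : S)} := by
    rw [Ideal.map_span]; simp
  have hmax : maximalIdeal R = Ideal.span {(p : R)} := hirr.maximalIdeal_eq
  have hcomp : IsAdicComplete (Ideal.span {(p : S)}) S := hmap ▸ aux_complete _
  have hinj : Function.Injective (algebraMap R S) := by
    have := FaithfulSMul.of_field_isFractionRing R S K L
    exact FaithfulSMul.algebraMap_injective R S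
  have hp0 : (p : S) ≠ 0 := by
    rw [← map_natCast (algebraMap R S), map_ne_zero_iff _ hinj]; exact hirr.ne_zero
  have hm0 : maximalIdeal S ≠ ⊥ := by
    intro h
    rw [h, Ideal.bot_pow (by omega), Ideal.span_singleton_eq_bot] at hram
    exact hp0 hram
  have hpm : (p : S) ∈ maximalIdeal S := by
    have : (p : S) ∈ maximalIdeal S ^ e := hram ▸ Ideal.mem_span_singleton_self _
    exact Ideal.pow_le_self (by omega) this
  have hidx : Ideal.ramificationIdx' (maximalIdeal R) (maximalIdeal S) = e := by
    apply Ideal.ramificationIdx'_spec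
    · rw [hmax, hmap, hram]
    · rw [hmax, hmap, hram]
      exact fun h => absurd (Ideal.pow_succ_lt_pow hm0 e) (not_lt_of_ge h)
  have hR0 : maximalIdeal R ≠ ⊥ := IsDiscreteValuationRing.not_a_field R
  have hf := Ideal.ramificationIdx_mul_inertiaDeg_of_isLocalRing S K L hR0
  rw [hidx, hrank] at hf
  have hf1 : (maximalIdeal R).inertiaDeg' (maximalIdeal S) = 1 :=
    Nat.eq_of_mul_eq_mul_left (by omega : 0 < e) (by omega)
  have hlo : (maximalIdeal S).LiesOver (maximalIdeal R) := by
    refine ⟨?_⟩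
    refine (maximalIdeal.isMaximal R).eq_of_le (Ideal.IsPrime.ne_top inferInstance) ?_
    rw [Ideal.under, ← Ideal.map_le_iff_le_comap, hmax, hmap, Ideal.span_singleton_le_iff_mem]
    exact hpm
  have hres : ∀ s : S, ∃ r : R, s - algebraMap R S r ∈ maximalIdeal S := by
    rw [Ideal.inertiaDeg'_algebraMap] at hf1
    letI := Ideal.Quotient.field (maximalIdeal R)
    intro s
    obtain ⟨c, hc⟩ := (finrank_eq_one_iff_of_nonzero' (K := R ⧸ maximalIdeal R) (1 : S ⧸ maximalIdeal S) one_ne_zero).1 hf1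
      (Ideal.Quotient.mk _ s)
    obtain ⟨r, rfl⟩ := Ideal.Quotient.mk_surjective c
    refine ⟨r, ?_⟩
    rw [← Ideal.Quotient.eq, ← hc, Algebra.smul_def, mul_one]
    rfl
  have hprin : (maximalIdeal S).IsPrincipal :=
    maximalIdeal_isPrincipal_of_isDedekindDomain S
  obtain ⟨ϖ, hϖ⟩ := hprin.principal
  have hram2 := hram
  rw [hϖ, Ideal.submodule_span_eq, Ideal.span_singleton_pow,
    Ideal.span_singleton_eq_span_singleton] at hram2
  obtain ⟨u, hu⟩ := hram2.symm
  obtain ⟨r, hr⟩ := hres u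
  have hmR : ∀ x ∈ maximalIdeal R, algebraMap R S x ∈ maximalIdeal S := by
    intro x hx
    have := hlo.over
    rw [this] at hx
    exact hx
  have hru : IsUnit r := by
    by_contra h
    have h2 := Ideal.add_mem _ hr (hmR r h)
    rw [sub_add_cancel] at h2
    exact h2 u.isUnit
  obtain ⟨v, hv⟩ := hdiv r hru
  have hv2 : algebraMap R S v ^ e - u ∈ maximalIdeal S := by
    have h1 : v ^ e - r ∈ maximalIdeal R := by rw [hmax, Ideal.mem_span_singleton]; exact hv
    have h2 := Ideal.sub_mem _ (hmR _ h1) hr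
    simpa using h2
  have hvu : IsUnit (algebraMap R S v) := by
    by_contra h
    have h2 := Ideal.sub_mem _ (Ideal.pow_mem_of_mem _ (h : algebraMap R S v ∈ maximalIdeal S) e he) hv2
    rw [sub_sub_cancel] at h2
    exact h2 u.isUnit
  obtain ⟨w, hw⟩ := hvu
  rw [← hw] at hv2
  obtain ⟨y, hy⟩ := aux_root p e he hpe hram ((u : S) * ((w⁻¹ : Sˣ) : S) ^ e) (by
    have h2 := Ideal.neg_mem_iff _ |>.2 (Ideal.mul_mem_right (((w⁻¹ : Sˣ) : S) ^ e) _ hv2)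
    convert h2 using 1
    rw [sub_mul, ← mul_pow]
    simp)
  refine ⟨ϖ * w * y, ?_⟩
  rw [mul_pow, mul_pow, hy, ← hu]
  have : (w : S) ^ e * ((w⁻¹ : Sˣ) : S) ^ e = 1 := by rw [← mul_pow]; simp
  linear_combination (ϖ ^ e * u) * this

theorem aux_irr {R K : Type} [CommRing R] [IsDomain R] [IsDiscreteValuationRing R] [Field K]
    [Algebra R K] [IsFractionRing R K] (p : R) (hirr : Irreducible p) (e : ℕ) (he : 1 ≤ e) :
    Irreducible (Polynomial.X ^ e - Polynomial.C (algebraMap R K p)) := by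
  have hm : (Polynomial.X ^ e - Polynomial.C p).Monic := Polynomial.monic_X_pow_sub_C _ (by omega)
  have hprime : Prime p := hirr.prime
  have h : Irreducible (Polynomial.X ^ e - Polynomial.C p) := by
    have hE : (Polynomial.X ^ e - Polynomial.C p).IsEisensteinAt (Ideal.span {p}) := by
      refine ⟨?_, ?_, ?_⟩
      · rw [hm.leadingCoeff, Ideal.mem_span_singleton]; exact fun h => hirr.not_isUnit (isUnit_of_dvd_one h)
      · intro n hn
        rw [Polynomial.natDegree_X_pow_sub_C] at hn
        rw [Polynomial.coeff_sub, Polynomial.coeff_X_pow, if_neg hn.ne, Polynomial.coeff_C, zero_sub]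
        split_ifs
        · exact Ideal.neg_mem_iff _ |>.2 (Ideal.mem_span_singleton_self _)
        · simp
      · rw [Polynomial.coeff_sub, Polynomial.coeff_X_pow, if_neg (by omega), Polynomial.coeff_C_zero, zero_sub,
          Ideal.neg_mem_iff, Ideal.span_singleton_pow, Ideal.mem_span_singleton]
        intro h
        have h2 : p * p ∣ p * 1 := by rw [mul_one, ← sq]; exact h
        exact hirr.not_isUnit (isUnit_of_dvd_one ((mul_dvd_mul_iff_left hirr.ne_zero).1 h2))
    exact hE.irreducible ((Ideal.span_singleton_prime hirr.ne_zero).2 hprime) hm.isPrimitive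
      (by rw [Polynomial.natDegree_X_pow_sub_C]; omega)
  rw [hm.irreducible_iff_irreducible_map_fraction_map (K := K)] at h
  simpa using h

theorem aux_equiv {K L : Type} [Field K] [Field L] [Algebra K L] (a : K) (e : ℕ) (he : 1 ≤ e)
    (hf : Irreducible (Polynomial.X ^ e - Polynomial.C a)) (hrank : Module.finrank K L = e)
    (x : L) (hx : x ^ e = algebraMap K L a) :
    Nonempty (AdjoinRoot (Polynomial.X ^ e - Polynomial.C a) ≃ₐ[K] L) := by
  have : Fact (Irreducible (Polynomial.X ^ e - Polynomial.C a)) := ⟨hf⟩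
  have : FiniteDimensional K L := FiniteDimensional.of_finrank_pos (by omega)
  let φ : AdjoinRoot (Polynomial.X ^ e - Polynomial.C a) →ₐ[K] L :=
    AdjoinRoot.liftAlgHom _ (Algebra.ofId K L) x (by simp [hx, Algebra.ofId_apply])
  have hfd : FiniteDimensional K (AdjoinRoot (Polynomial.X ^ e - Polynomial.C a)) :=
    (AdjoinRoot.powerBasis hf.ne_zero).finite
  have hr : Module.finrank K (AdjoinRoot (Polynomial.X ^ e - Polynomial.C a)) = Module.finrank K L := by
    rw [hrank, (AdjoinRoot.powerBasis hf.ne_zero).finrank, AdjoinRoot.powerBasis_dim,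
      Polynomial.natDegree_X_pow_sub_C]
  have hinj : Function.Injective φ := φ.toRingHom.injective
  exact ⟨AlgEquiv.ofBijective φ ⟨hinj, (LinearMap.injective_iff_surjective_of_finrank_eq_finrank (f := φ.toLinearMap) hr).1 hinj⟩⟩

theorem aux_charZero (p : ℕ) [Fact p.Prime]
    (k : Type) [Field k] [CharP k p] [PerfectRing k p] : CharZero (WittVector p k) := by
  have hp := Fact.out (p := p.Prime)
  refine charZero_of_inj_zero fun n hn => ?_
  by_contra h0
  obtain ⟨a, m, hm, rfl⟩ := Nat.exists_eq_pow_mul_and_not_dvd h0 p hp.ne_one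
  rw [Nat.cast_mul, Nat.cast_pow, mul_eq_zero] at hn
  rcases hn with hn | hn
  · exact (WittVector.irreducible p (k := k)).ne_zero (eq_zero_of_pow_eq_zero hn)
  · have h2 := congrArg (WittVector.constantCoeff (p := p) (R := k)) hn
    rw [map_natCast, map_zero, CharP.cast_eq_zero_iff k p] at h2
    exact hm h2

theorem aux_one (p : ℕ) [Fact p.Prime]
    (k : Type) [Field k] [CharP k p] [PerfectRing k p]
    (e : ℕ) (he : 1 ≤ e) (hpe : ¬ p ∣ e)
    (hdiv : ∀ a : kˣ, ∃ b : kˣ, b ^ e = a)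
    (L₁ : Type) [Field L₁] [Algebra (WittVector p k) L₁]
    [Algebra (FractionRing (WittVector p k)) L₁]
    [IsScalarTower (WittVector p k) (FractionRing (WittVector p k)) L₁]
    [IsLocalRing (integralClosure (WittVector p k) L₁)]
    (hrank₁ : Module.finrank (FractionRing (WittVector p k)) L₁ = e)
    (hram₁ : Ideal.span {(p : ↥(integralClosure (WittVector p k) L₁))} =
      maximalIdeal (integralClosure (WittVector p k) L₁) ^ e) :
    Nonempty (AdjoinRoot (Polynomial.X ^ e - Polynomial.C
      (algebraMap (WittVector p k) (FractionRing (WittVector p k)) p))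
        ≃ₐ[FractionRing (WittVector p k)] L₁) := by
  have hirr : Irreducible (p : WittVector p k) := WittVector.irreducible p
  have hc := aux_charZero p k
  have hcK : CharZero (FractionRing (WittVector p k)) :=
    charZero_of_injective_algebraMap (IsFractionRing.injective (WittVector p k) _)
  have hfd : FiniteDimensional (FractionRing (WittVector p k)) L₁ :=
    FiniteDimensional.of_finrank_pos (by omega)
  have hfin : Module.Finite (WittVector p k) (integralClosure (WittVector p k) L₁) :=
    IsIntegralClosure.finite (WittVector p k) (FractionRing (WittVector p k)) L₁ _
  have hfrac : IsFractionRing (integralClosure (WittVector p k) L₁) L₁ :=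
    IsIntegralClosure.isFractionRing_of_finite_extension (WittVector p k)
      (FractionRing (WittVector p k)) L₁ _
  obtain ⟨x, hx⟩ := aux_key (R := WittVector p k) (K := FractionRing (WittVector p k)) (L := L₁)
    p hirr e he hpe (by
      intro u hu
      have h0 : IsUnit (WittVector.constantCoeff u) := hu.map _
      obtain ⟨a, ha⟩ := h0
      obtain ⟨b, hb⟩ := hdiv a
      refine ⟨WittVector.teichmuller p (b : k), ?_⟩
      rw [← Ideal.mem_span_singleton, ← WittVector.ker_constantCoeff, RingHom.mem_ker, map_sub,
        ← ha, ← hb, map_pow]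
      simp [WittVector.constantCoeff_apply, WittVector.teichmuller_coeff_zero]) hrank₁ hram₁
  refine aux_equiv _ e he (aux_irr _ hirr e he) hrank₁ (x : L₁) ?_
  have := congrArg (algebraMap (integralClosure (WittVector p k) L₁) L₁) hx
  simpa using this

/-- If `p ∤ e` and the unit group of the perfect field `k` of characteristic `p` is
`e`-divisible, then any two totally ramified extensions of degree `e` of
`K = Frac(W(k))` are isomorphic as `K`-algebras. -/
theorem tame_totally_ramified_unique (p : ℕ) [Fact p.Prime]
    (k : Type) [Field k] [CharP k p] [PerfectRing k p]
    (e : ℕ) (he : 1 ≤ e) (hpe : ¬ p ∣ e)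
    (hdiv : ∀ a : kˣ, ∃ b : kˣ, b ^ e = a)
    (L₁ L₂ : Type) [Field L₁] [Field L₂]
    [Algebra (WittVector p k) L₁] [Algebra (WittVector p k) L₂]
    [Algebra (FractionRing (WittVector p k)) L₁]
    [Algebra (FractionRing (WittVector p k)) L₂]
    [IsScalarTower (WittVector p k) (FractionRing (WittVector p k)) L₁]
    [IsScalarTower (WittVector p k) (FractionRing (WittVector p k)) L₂]
    [IsLocalRing (integralClosure (WittVector p k) L₁)]
    [IsLocalRing (integralClosure (WittVector p k) L₂)]
    (hrank₁ : Module.finrank (FractionRing (WittVector p k)) L₁ = e)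
    (hrank₂ : Module.finrank (FractionRing (WittVector p k)) L₂ = e)
    (hram₁ : Ideal.span {(p : ↥(integralClosure (WittVector p k) L₁))} =
      maximalIdeal (integralClosure (WittVector p k) L₁) ^ e)
    (hram₂ : Ideal.span {(p : ↥(integralClosure (WittVector p k) L₂))} =
      maximalIdeal (integralClosure (WittVector p k) L₂) ^ e) :
    Nonempty (L₁ ≃ₐ[FractionRing (WittVector p k)] L₂) := by
  obtain ⟨f₁⟩ := aux_one p k e he hpe hdiv L₁ hrank₁ hram₁
  obtain ⟨f₂⟩ := aux_one p k e he hpe hdiv L₂ hrank₂ hram₂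
  exact ⟨f₁.symm.trans f₂⟩
end

section
/- Let p be a prime and let K₁ and K₂ be fields equipped with ℚ_[p]-algebra structures that are finite-dimensional as ℚ_[p]-vector spaces. Let Rᵢ be the integral closure of ℤ_[p] in Kᵢ, which is a local ring; let 𝔪ᵢ be its maximal ideal. If for every integer n ≥ 1 there exists a ring isomorphism R₁/𝔪₁^n ≃ R₂/𝔪₂^n, then there exists a ℚ_[p]-algebra isomorphism K₁ ≃ₐ[ℚ_[p]] K₂. -/
set_option synthInstance.maxHeartbeats 1000000
set_option maxHeartbeats 1000000

open IsLocalRing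

/-- A polynomial with approximate roots modulo every power of the maximal ideal has a root. -/
theorem aux_root_s17 (p : ℕ) [Fact p.Prime] (R : Type) [CommRing R] [Algebra ℤ_[p] R] [IsLocalRing R]
    [Module.Finite ℤ_[p] R] [Module.Free ℤ_[p] R] (f : Polynomial ℤ_[p])
    (hf : ∀ n : ℕ, ∃ b : R, Polynomial.aeval b f ∈ maximalIdeal R ^ n) :
    ∃ b : R, Polynomial.aeval b f = 0 := by
  let : TopologicalSpace R := moduleTopology ℤ_[p] R
  have : IsModuleTopology ℤ_[p] R := ⟨rfl⟩
  have : IsTopologicalRing R := IsModuleTopology.isTopologicalRing ℤ_[p] R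
  have : IsNoetherianRing R := IsNoetherianRing.of_finite ℤ_[p] R
  have : CompactSpace R := Module.Finite.compactSpace ℤ_[p] R
  have : T2Space R := by
    let e := (Module.Free.chooseBasis ℤ_[p] R).equivFun
    have he : Continuous e := IsModuleTopology.continuous_of_linearMap e.toLinearMap
    exact T2Space.of_injective_continuous e.injective he
  have hc : Continuous fun b : R => Polynomial.aeval b f := by fun_prop
  obtain ⟨b, hb⟩ := IsCompact.nonempty_iInter_of_sequence_nonempty_isCompact_isClosed
    (fun n : ℕ => (fun b : R => Polynomial.aeval b f) ⁻¹' ((maximalIdeal R ^ n : Ideal R) : Set R))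
    (fun n b hb => Ideal.pow_le_pow_right (Nat.le_succ n) hb) hf
    (by simpa using isCompact_univ)
    (fun n => (Ideal.isCompact_of_fg (IsNoetherian.noetherian _)).isClosed.preimage hc)
  refine ⟨b, ?_⟩
  have : Polynomial.aeval b f ∈ (⨅ n : ℕ, maximalIdeal R ^ n) := by
    simpa [Ideal.mem_iInf] using hb
  rwa [Ideal.iInf_pow_eq_bot_of_isLocalRing _ (maximalIdeal.isMaximal R).ne_top] at this

theorem aux_p_mem (p : ℕ) [Fact p.Prime] (R : Type) [CommRing R] [Algebra ℤ_[p] R] [IsLocalRing R]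
    [Algebra.IsIntegral ℤ_[p] R] [FaithfulSMul ℤ_[p] R] : (p : R) ∈ maximalIdeal R := by
  rw [mem_maximalIdeal, mem_nonunits_iff]
  intro h
  have h2 : IsUnit (algebraMap ℤ_[p] R p) := by simpa using h
  have h3 := isUnit_of_map_unit (algebraMap ℤ_[p] R) _ h2
  exact PadicInt.prime_p.not_isUnit h3

theorem aux_comm (p : ℕ) [Fact p.Prime] (A B : Type) [CommRing A] [CommRing B] [Algebra ℤ_[p] A]
    [Algebra ℤ_[p] B] (n : ℕ) (hA : (p : A) ^ n = 0) (hB : (p : B) ^ n = 0) (φ : A →+* B)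
    (a : ℤ_[p]) : φ (algebraMap ℤ_[p] A a) = algebraMap ℤ_[p] B a := by
  obtain ⟨c, hc⟩ := Ideal.mem_span_singleton.1 (PadicInt.appr_spec n a)
  rw [sub_eq_iff_eq_add] at hc
  rw [hc]
  simp [hA, hB]

theorem aux_emb (p : ℕ) [Fact p.Prime]
    (K₁ K₂ : Type) [Field K₁] [Field K₂]
    [Algebra ℚ_[p] K₁] [Algebra ℚ_[p] K₂]
    [FiniteDimensional ℚ_[p] K₁] [FiniteDimensional ℚ_[p] K₂]
    [Algebra ℤ_[p] K₁] [Algebra ℤ_[p] K₂]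
    [IsScalarTower ℤ_[p] ℚ_[p] K₁] [IsScalarTower ℤ_[p] ℚ_[p] K₂]
    [IsLocalRing (integralClosure ℤ_[p] K₁)] [IsLocalRing (integralClosure ℤ_[p] K₂)]
    (h : ∀ n : ℕ, 1 ≤ n →
      Nonempty ((↥(integralClosure ℤ_[p] K₁) ⧸ maximalIdeal (integralClosure ℤ_[p] K₁) ^ n) ≃+*
        (↥(integralClosure ℤ_[p] K₂) ⧸ maximalIdeal (integralClosure ℤ_[p] K₂) ^ n))) :
    Nonempty (K₁ →ₐ[ℚ_[p]] K₂) := by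
  have inj1 : Function.Injective (algebraMap ℤ_[p] K₁) := by
    rw [IsScalarTower.algebraMap_eq ℤ_[p] ℚ_[p] K₁]
    exact (algebraMap ℚ_[p] K₁).injective.comp (IsFractionRing.injective ℤ_[p] ℚ_[p])
  have inj2 : Function.Injective (algebraMap ℤ_[p] K₂) := by
    rw [IsScalarTower.algebraMap_eq ℤ_[p] ℚ_[p] K₂]
    exact (algebraMap ℚ_[p] K₂).injective.comp (IsFractionRing.injective ℤ_[p] ℚ_[p])
  have : FaithfulSMul ℤ_[p] K₁ := (faithfulSMul_iff_algebraMap_injective _ _).2 inj1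
  have : FaithfulSMul ℤ_[p] K₂ := (faithfulSMul_iff_algebraMap_injective _ _).2 inj2
  have : Module.IsTorsionFree ℤ_[p] K₂ := inferInstance
  have : Module.Finite ℤ_[p] (integralClosure ℤ_[p] K₂) :=
    IsIntegralClosure.finite ℤ_[p] ℚ_[p] K₂ _
  have : Module.Free ℤ_[p] (integralClosure ℤ_[p] K₂) :=
    IsIntegralClosure.module_free ℤ_[p] ℚ_[p] K₂ _
  have : FaithfulSMul ℤ_[p] (integralClosure ℤ_[p] K₁) :=
    (faithfulSMul_iff_algebraMap_injective _ _).2 fun a b hab => inj1 (congrArg Subtype.val hab)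
  have : FaithfulSMul ℤ_[p] (integralClosure ℤ_[p] K₂) :=
    (faithfulSMul_iff_algebraMap_injective _ _).2 fun a b hab => inj2 (congrArg Subtype.val hab)
  obtain ⟨θ, hθ⟩ := Field.exists_primitive_element ℚ_[p] K₁
  have halg : IsAlgebraic ℤ_[p] θ :=
    (IsFractionRing.isAlgebraic_iff ℤ_[p] ℚ_[p] K₁).2 (Algebra.IsAlgebraic.isAlgebraic θ)
  obtain ⟨y, hy0, hy⟩ := halg.exists_integral_multiple
  have htop : IntermediateField.adjoin ℚ_[p] {y • θ} = ⊤ := by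
    rw [eq_top_iff, ← hθ, IntermediateField.adjoin_simple_le_iff]
    have hy' : (y : ℚ_[p]) ≠ 0 := by simpa using hy0
    have e : θ = (y : ℚ_[p])⁻¹ • (y • θ) := by
      rw [← algebraMap_smul ℚ_[p] y θ, smul_smul]
      change θ = ((y : ℚ_[p])⁻¹ * (y : ℚ_[p])) • θ
      rw [inv_mul_cancel₀ hy', one_smul]
    have hm := IntermediateField.mem_adjoin_simple_self ℚ_[p] (y • θ)
    have := (IntermediateField.adjoin ℚ_[p] {y • θ}).smul_mem hm (x := (y : ℚ_[p])⁻¹)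
    rwa [← e] at this
  let α : integralClosure ℤ_[p] K₁ := ⟨y • θ, hy⟩
  have hα : Polynomial.aeval α (minpoly ℤ_[p] (y • θ)) = 0 := by
    apply Subtype.ext
    exact (Polynomial.aeval_algebraMap_apply K₁ α _).symm.trans (minpoly.aeval ℤ_[p] (y • θ))
  obtain ⟨β, hβ⟩ := aux_root_s17 p (integralClosure ℤ_[p] K₂) (minpoly ℤ_[p] (y • θ)) (by
    intro n
    rcases Nat.eq_zero_or_pos n with rfl | hn
    · exact ⟨0, by simp⟩
    obtain ⟨φ⟩ := h n hn
    obtain ⟨b, hb⟩ := Ideal.Quotient.mk_surjective (φ (Ideal.Quotient.mk _ α))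
    refine ⟨b, ?_⟩
    let ψ : (↥(integralClosure ℤ_[p] K₁) ⧸ maximalIdeal (integralClosure ℤ_[p] K₁) ^ n) →ₐ[ℤ_[p]]
        (↥(integralClosure ℤ_[p] K₂) ⧸ maximalIdeal (integralClosure ℤ_[p] K₂) ^ n) :=
      { (φ : _ →+* _) with
        commutes' := aux_comm p _ _ n
          (by
            have := Ideal.pow_mem_pow (aux_p_mem p (integralClosure ℤ_[p] K₁)) n
            simpa using Ideal.Quotient.eq_zero_iff_mem.2 this)
          (by
            have := Ideal.pow_mem_pow (aux_p_mem p (integralClosure ℤ_[p] K₂)) n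
            simpa using Ideal.Quotient.eq_zero_iff_mem.2 this)
          (φ : _ →+* _) }
    have h1 : Ideal.Quotient.mkₐ ℤ_[p] (maximalIdeal (integralClosure ℤ_[p] K₂) ^ n) b
      = ψ (Ideal.Quotient.mkₐ ℤ_[p] (maximalIdeal (integralClosure ℤ_[p] K₁) ^ n) α) := hb
    have h2 : Ideal.Quotient.mkₐ ℤ_[p] (maximalIdeal (integralClosure ℤ_[p] K₂) ^ n)
        (Polynomial.aeval b (minpoly ℤ_[p] (y • θ))) = 0 := by
      rw [← Polynomial.aeval_algHom_apply, h1, Polynomial.aeval_algHom_apply,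
        Polynomial.aeval_algHom_apply, hα, map_zero, map_zero]
    exact Ideal.Quotient.eq_zero_iff_mem.1 h2)
  have hroot : Polynomial.aeval (β : K₂) (minpoly ℚ_[p] (y • θ)) = 0 := by
    rw [minpoly.isIntegrallyClosed_eq_field_fractions' ℚ_[p] hy, Polynomial.aeval_map_algebraMap]
    have := congrArg (algebraMap _ K₂) hβ
    rw [← Polynomial.aeval_algebraMap_apply, map_zero] at this
    exact this
  have hint : IsIntegral ℚ_[p] (y • θ) := Algebra.IsIntegral.isIntegral _
  let g : IntermediateField.adjoin ℚ_[p] {y • θ} →ₐ[ℚ_[p]] K₂ :=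
    (IntermediateField.adjoin.powerBasis hint).lift (β : K₂) (by
      rw [IntermediateField.adjoin.powerBasis_gen, IntermediateField.minpoly_gen]
      exact hroot)
  exact ⟨g.comp ((IntermediateField.equivOfEq htop.symm).toAlgHom.comp
    IntermediateField.topEquiv.symm.toAlgHom)⟩

/-- Two finite extensions of `ℚ_[p]` whose rings of integers have isomorphic `n`-th
residue rings for every `n ≥ 1` are isomorphic as `ℚ_[p]`-algebras. -/
theorem padic_fields_iso_of_residue_rings_iso (p : ℕ) [Fact p.Prime]
    (K₁ K₂ : Type) [Field K₁] [Field K₂]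
    [Algebra ℚ_[p] K₁] [Algebra ℚ_[p] K₂]
    [FiniteDimensional ℚ_[p] K₁] [FiniteDimensional ℚ_[p] K₂]
    [Algebra ℤ_[p] K₁] [Algebra ℤ_[p] K₂]
    [IsScalarTower ℤ_[p] ℚ_[p] K₁] [IsScalarTower ℤ_[p] ℚ_[p] K₂]
    [IsLocalRing (integralClosure ℤ_[p] K₁)] [IsLocalRing (integralClosure ℤ_[p] K₂)]
    (h : ∀ n : ℕ, 1 ≤ n →
      Nonempty ((↥(integralClosure ℤ_[p] K₁) ⧸ maximalIdeal (integralClosure ℤ_[p] K₁) ^ n) ≃+*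
        (↥(integralClosure ℤ_[p] K₂) ⧸ maximalIdeal (integralClosure ℤ_[p] K₂) ^ n))) :
    Nonempty (K₁ ≃ₐ[ℚ_[p]] K₂) := by
  obtain ⟨f⟩ := aux_emb p K₁ K₂ h
  obtain ⟨g⟩ := aux_emb p K₂ K₁ fun n hn => (h n hn).map RingEquiv.symm
  have h1 := LinearMap.finrank_le_finrank_of_injective (f := f.toLinearMap) f.toRingHom.injective
  have h2 := LinearMap.finrank_le_finrank_of_injective (f := g.toLinearMap) g.toRingHom.injective
  have hs := (LinearMap.injective_iff_surjective_of_finrank_eq_finrank (f := f.toLinearMap)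
    (le_antisymm h1 h2)).1 f.toRingHom.injective
  exact ⟨AlgEquiv.ofBijective f ⟨f.toRingHom.injective, hs⟩⟩
end
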